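/- There exists n₀ ∈ ℕ such that for every n > n₀ and every q ≥ 0, the Shannon depth function satisfies D(n,q) ≥ 2ⁿ·(n−2)/(3·(n+q)·log₂(n+q)) − n/(3·(n+q)). -/

import Mathlib

namespace RevCirc

/-- A reversible gate on `n` wires: a target coordinate together with a set of
at most two control coordinates not containing the target.  With no controls it
is a NOT gate, with one control a CNOT gate and with two controls a 2-CNOT
(Toffoli) gate. -/
abbrev Gate (n : ℕ) : Type :=
  {p : Fin n × Finset (Fin n) // p.2.card ≤ 2 ∧ p.1 ∉ p.2}

def Gate.target {n : ℕ} (g : Gate n) : Fin n := g.1.1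

def Gate.controls {n : ℕ} (g : Gate n) : Finset (Fin n) := g.1.2

/-- The transformation of `ℤ₂ⁿ` defined by a gate: the target coordinate is
XOR-ed with the conjunction of the control coordinates. -/
def Gate.apply {n : ℕ} (g : Gate n) (x : Fin n → Bool) : Fin n → Bool :=
  fun i => if i = g.target then xor (x i) (decide (∀ j ∈ g.controls, x j = true)) else x i

/-- The transformation defined by a circuit (a list of gates, applied left to right). -/
def evalCircuit {n : ℕ} (c : List (Gate n)) (x : Fin n → Bool) : Fin n → Bool :=
  c.foldl (fun y g => g.apply y) x

/-- A circuit realizes a permutation `h` of `ℤ₂ⁿ` (without additional inputs) if the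
composition of its gates equals `h`. -/
def realizes {n : ℕ} (c : List (Gate n)) (h : Equiv.Perm (Fin n → Bool)) : Prop :=
  ∀ x, evalCircuit c x = h x

/-- The expanding function `ℤ₂ⁿ → ℤ₂^{n+q}` padding with zeros. -/
def expand (n q : ℕ) (x : Fin n → Bool) : Fin (n + q) → Bool :=
  fun i => if h : (i : ℕ) < n then x ⟨i, h⟩ else false

/-- A circuit with `n+q` inputs implements `f : ℤ₂ⁿ → ℤ₂ⁿ` using `q` additional
inputs if for some permutation `π` of the wires, the coordinates `π(1),…,π(n)` of the
output on the zero-padded input give `f`. -/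
def implements (n q : ℕ) (c : List (Gate (n + q)))
    (f : (Fin n → Bool) → (Fin n → Bool)) : Prop :=
  ∃ π : Equiv.Perm (Fin (n + q)), ∀ x : Fin n → Bool, ∀ i : Fin n,
    evalCircuit c (expand n q x) (π (Fin.castLE (Nat.le_add_right n q) i)) = f x i

/-- `F(n,q)`: the set of transformations `ℤ₂ⁿ → ℤ₂ⁿ` implementable by reversible
circuits with `n+q` inputs. -/
def FSet (n q : ℕ) : Set ((Fin n → Bool) → (Fin n → Bool)) :=
  {f | ∃ c : List (Gate (n + q)), implements n q c f}

/-- The set of wires touched by a gate: its target together with its controls. -/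
def Gate.support {n : ℕ} (g : Gate n) : Finset (Fin n) := insert g.target g.controls

/-- A circuit has depth 1 if the supports of its gates are pairwise disjoint. -/
def DepthOne {n : ℕ} (c : List (Gate n)) : Prop :=
  c.Pairwise fun g₁ g₂ => Disjoint g₁.support g₂.support

/-- The depth of a circuit: the minimal number of consecutive depth-1 sub-circuits
into which it can be divided. -/
noncomputable def depth {n : ℕ} (c : List (Gate n)) : ℕ :=
  sInf {d | ∃ parts : List (List (Gate n)),
    parts.flatten = c ∧ (∀ p ∈ parts, DepthOne p) ∧ parts.length = d}

/-- The quantum weight of a circuit: each NOT and CNOT gate weighs `WC`, each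
2-CNOT gate weighs `WT`. -/
def weight {n : ℕ} (WC WT : ℝ) (c : List (Gate n)) : ℝ :=
  (c.map fun g => if g.controls.card = 2 then WT else WC).sum

/-- `L(f,q)`: minimal gate complexity of a circuit implementing `f` with `q`
additional inputs. -/
noncomputable def Lmin (n q : ℕ) (f : (Fin n → Bool) → (Fin n → Bool)) : ℕ :=
  sInf {l | ∃ c : List (Gate (n + q)), implements n q c f ∧ c.length = l}

/-- The Shannon gate complexity function `L(n,q)`. -/
noncomputable def ShannonL (n q : ℕ) : ℕ := sSup (Lmin n q '' FSet n q)

/-- `D(f,q)`: minimal depth of a circuit implementing `f` with `q` additional inputs. -/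
noncomputable def Dmin (n q : ℕ) (f : (Fin n → Bool) → (Fin n → Bool)) : ℕ :=
  sInf {d | ∃ c : List (Gate (n + q)), implements n q c f ∧ depth c = d}

/-- The Shannon depth function `D(n,q)`. -/
noncomputable def ShannonD (n q : ℕ) : ℕ := sSup (Dmin n q '' FSet n q)

/-- `W(f,q)`: minimal quantum weight of a circuit implementing `f` with `q`
additional inputs. -/
noncomputable def Wmin (WC WT : ℝ) (n q : ℕ) (f : (Fin n → Bool) → (Fin n → Bool)) : ℝ :=
  sInf {w | ∃ c : List (Gate (n + q)), implements n q c f ∧ weight WC WT c = w}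

/-- The Shannon quantum weight function `W(n,q)`. -/
noncomputable def ShannonW (WC WT : ℝ) (n q : ℕ) : ℝ := sSup (Wmin WC WT n q '' FSet n q)

/-- A permutation is a product of `K` pairwise disjoint (independent) transpositions:
there are `2K` pairwise distinct points `x i, y i` with `g = (x 1, y 1)∘⋯∘(x K, y K)`. -/
def IsProdOfDisjointTranspositions {X : Type*} [DecidableEq X] (K : ℕ)
    (g : Equiv.Perm X) : Prop :=
  ∃ x y : Fin K → X,
    Function.Injective (Sum.elim x y) ∧
    g = ((List.finRange K).map fun i => Equiv.swap (x i) (y i)).prod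

end RevCirc

namespace RevCirc

/-- NOT gate on `t` controlled by an arbitrary set `S`. -/
def cn {n : ℕ} (S : Finset (Fin n)) (t : Fin n) (x : Fin n → Bool) : Fin n → Bool :=
  fun i => if i = t then xor (x i) (decide (∀ j ∈ S, x j = true)) else x i

theorem cn_target {n : ℕ} (S : Finset (Fin n)) (t : Fin n) (x : Fin n → Bool) :
    cn S t x t = xor (x t) (decide (∀ j ∈ S, x j = true)) := by simp [cn]

theorem cn_other {n : ℕ} (S : Finset (Fin n)) (t : Fin n) (x : Fin n → Bool) {i : Fin n}
    (h : i ≠ t) : cn S t x i = x i := by simp [cn, h]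

theorem cn_all {n : ℕ} (S : Finset (Fin n)) (t : Fin n) (T : Finset (Fin n)) (h : t ∉ T)
    (x : Fin n → Bool) :
    (∀ j ∈ T, cn S t x j = true) ↔ (∀ j ∈ T, x j = true) := by
  refine forall₂_congr fun j hj => ?_
  rw [cn_other]
  rintro rfl
  exact h hj

theorem cn_invol {n : ℕ} (S : Finset (Fin n)) (t : Fin n) (h : t ∉ S) :
    Function.Involutive (cn S t) := by
  intro x
  ext i
  by_cases hi : i = t
  · subst hi
    rw [cn_target, cn_target]
    simp only [cn_all S i S h]
    simp
  · rw [cn_other _ _ _ hi, cn_other _ _ _ hi]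

def cnp {n : ℕ} (S : Finset (Fin n)) (t : Fin n) (h : t ∉ S) : Equiv.Perm (Fin n → Bool) :=
  (cn_invol S t h).toPerm

@[simp] theorem cnp_apply {n : ℕ} (S : Finset (Fin n)) (t : Fin n) (h : t ∉ S)
    (x : Fin n → Bool) : cnp S t h x = cn S t x := rfl

theorem cnp_mul_self {n : ℕ} (S : Finset (Fin n)) (t : Fin n) (h : t ∉ S) (x) :
    cnp S t h (cnp S t h x) = x := cn_invol S t h x

theorem Gate.apply_eq {n : ℕ} (g : Gate n) : g.apply = cn g.controls g.target := rfl

/-- The group generated by the gates. -/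
def HG (n : ℕ) : Subgroup (Equiv.Perm (Fin n → Bool)) where
  carrier := {h | ∃ c : List (Gate n), realizes c h}
  one_mem' := ⟨[], fun x => rfl⟩
  mul_mem' := by
    rintro a b ⟨c, hc⟩ ⟨d, hd⟩
    refine ⟨d ++ c, fun x => ?_⟩
    have h1 := hd x
    have h2 := hc (b x)
    simp only [evalCircuit, List.foldl_append] at *
    rw [h1, h2]; rfl
  inv_mem' := by
    rintro a ⟨c, hc⟩
    refine ⟨c.reverse, fun x => ?_⟩
    have key : ∀ (c : List (Gate n)) (y : Fin n → Bool),
        evalCircuit c.reverse (evalCircuit c y) = y := by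
      intro c
      induction c with
      | nil => intro y; rfl
      | cons g c ih =>
        intro y
        have := ih (g.apply y)
        simp only [evalCircuit, List.reverse_cons, List.foldl_append, List.foldl_cons,
          List.foldl_nil] at *
        rw [this]
        exact cn_invol g.controls g.target g.2.2 y
    have h1 := key c (a⁻¹ x)
    rw [hc] at h1
    simpa using h1

theorem cnp_mem_small {n : ℕ} (S : Finset (Fin n)) (t : Fin n) (h : t ∉ S) (hS : S.card ≤ 2) :
    cnp S t h ∈ HG n :=
  ⟨[⟨(t, S), hS, h⟩], fun x => rfl⟩

theorem cn_comm {n : ℕ} (S : Finset (Fin n)) (a t w : Fin n) (hat : a ≠ t)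
    (haw : a ≠ w) (hwt : w ≠ t) (hw : w ∉ S) (ht : t ∉ S) (x : Fin n → Bool) :
    cn S w (cn {a, w} t (cn S w (cn {a, w} t x))) = cn (insert a S) t x := by
  have e : ∀ y : Fin n → Bool, cn {a, w} t y t = xor (y t) (y a && y w) := by
    intro y; rw [cn_target]; simp
  have r : ∀ y : Fin n → Bool, decide (∀ j ∈ S, cn {a, w} t y j = true) =
      decide (∀ j ∈ S, y j = true) := by
    intro y; simp only [cn_all _ _ _ ht]
  have r' : ∀ y : Fin n → Bool, decide (∀ j ∈ S, cn S w y j = true) =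
      decide (∀ j ∈ S, y j = true) := by
    intro y; simp only [cn_all _ _ _ hw]
  ext i
  by_cases hit : i = t
  · subst hit
    rw [cn_other _ _ _ hwt.symm, e, cn_other _ _ _ hwt.symm, e, cn_target, cn_other _ _ _ haw,
      cn_other _ _ _ hat, cn_target, cn_other _ _ _ hwt, r]
    have : decide (∀ j ∈ insert a S, x j = true) = (x a && decide (∀ j ∈ S, x j = true)) := by
      simp
    rw [this]
    cases x i <;> cases x a <;> cases x w <;> cases decide (∀ j ∈ S, x j = true) <;> rfl
  · rw [cn_other _ _ _ hit]
    by_cases hiw : i = w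
    · subst hiw
      rw [cn_target, cn_other _ _ _ hit, cn_target, cn_other _ _ _ hit, r, r, r', r]
      simp
    · rw [cn_other _ _ _ hiw, cn_other _ _ _ hit, cn_other _ _ _ hiw, cn_other _ _ _ hit]

theorem cnp_mem {n : ℕ} : ∀ (k : ℕ) (S : Finset (Fin n)) (t : Fin n) (h : t ∉ S),
    S.card = k → (∃ w, w ∉ S ∧ w ≠ t) → cnp S t h ∈ HG n := by
  intro k
  induction k with
  | zero => intro S t h hk _; exact cnp_mem_small S t h (by omega)
  | succ k ih =>
    intro S t h hk hw
    obtain ⟨w, hwS, hwt⟩ := hw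
    obtain ⟨a, S', _, rfl, hS'⟩ := Finset.card_eq_succ.1 hk
    simp only [Finset.mem_insert, not_or] at h hwS
    have h1 : cnp S' w hwS.2 ∈ HG n := ih S' w hwS.2 hS' ⟨t, h.2, hwt.symm⟩
    have h2' : t ∉ ({a, w} : Finset (Fin n)) := by
      simp [h.1, hwt.symm]
    have h2 : cnp {a, w} t h2' ∈ HG n := cnp_mem_small _ _ _ Finset.card_le_two
    have h3 := mul_mem (mul_mem (mul_mem h1 h2) h1) h2
    convert h3 using 1
    ext1 x
    exact (cn_comm S' a t w (Ne.symm h.1) (Ne.symm hwS.1) hwt hwS.2 h.2 x).symm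

theorem comm_threeCycle {α : Type*} [Fintype α] [DecidableEq α] (s t : Equiv.Perm α) (x : α)
    (hs : ∀ y, s (s y) = y) (ht : ∀ y, t (t y) = y)
    (h : ∀ y, s y = y ∨ t y = y ∨ y = x) (hsx : s x ≠ x) (htx : t x ≠ x) :
    (s * t * s * t).IsThreeCycle := by
  have ha : t (s x) = s x := by
    rcases h (s x) with h1 | h1 | h1
    · rw [hs] at h1; exact absurd h1.symm hsx
    · exact h1
    · exact absurd h1 hsx
  have hb : s (t x) = t x := by
    rcases h (t x) with h1 | h1 | h1
    · exact h1
    · rw [ht] at h1; exact absurd h1.symm htx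
    · exact absurd h1 htx
  have hab : t x ≠ s x := by
    intro e
    rw [← e, ht] at ha
    exact htx ha.symm
  have key : s * t * s * t = Equiv.swap x (t x) * Equiv.swap x (s x) := by
    ext1 y
    simp only [Equiv.Perm.mul_apply]
    by_cases h1 : y = x
    · subst h1
      rw [hb, ht, Equiv.swap_apply_left, Equiv.swap_apply_of_ne_of_ne hsx hab.symm]
    by_cases h2 : y = s x
    · subst h2
      rw [ha, hs, hb, Equiv.swap_apply_right, Equiv.swap_apply_left]
    by_cases h3 : y = t x
    · subst h3
      rw [ht, ha, hs, Equiv.swap_apply_of_ne_of_ne htx hab, Equiv.swap_apply_right]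
    rw [Equiv.swap_apply_of_ne_of_ne h1 h2, Equiv.swap_apply_of_ne_of_ne h1 h3]
    by_cases h4 : t y = y
    · rw [h4]
      by_cases h5 : s y = y
      · rw [h5, h4, h5]
      · rcases h (s y) with h6 | h6 | h6
        · rw [hs] at h6; exact absurd h6.symm h5
        · rw [h6, hs]
        · exact absurd (by rw [← h6, hs]) h2
    · have h5 : s y = y := by
        rcases h y with h6 | h6 | h6
        · exact h6
        · exact absurd h6 h4
        · exact absurd h6 h1
      rcases h (t y) with h6 | h6 | h6
      · rw [h6, ht, h5]
      · rw [ht] at h6; exact absurd h6.symm h4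
      · exact absurd (by rw [← h6, ht]) h3
  rw [key]
  exact Equiv.Perm.isThreeCycle_swap_mul_swap_same htx.symm hsx.symm hab

theorem exists_threeCycle {n : ℕ} (hn : 4 ≤ n) : ∃ g ∈ HG n, g.IsThreeCycle := by
  let i : Fin n := ⟨0, by omega⟩
  let j : Fin n := ⟨1, by omega⟩
  let a : Fin n := ⟨2, by omega⟩
  let b : Fin n := ⟨3, by omega⟩
  let A : Finset (Fin n) := Finset.univ \ {j, a}
  let B : Finset (Fin n) := Finset.univ \ {i, b}
  have hA : j ∉ A := by simp [A]
  have hB : i ∉ B := by simp [B]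
  have h1 : cnp A j hA ∈ HG n := cnp_mem _ _ _ hA rfl ⟨a, by simp [A], by simp [a, j]⟩
  have h2 : cnp B i hB ∈ HG n := cnp_mem _ _ _ hB rfl ⟨b, by simp [B], by simp [b, i]⟩
  refine ⟨_, mul_mem (mul_mem (mul_mem h1 h2) h1) h2, ?_⟩
  have fix : ∀ (S : Finset (Fin n)) (t : Fin n) (y : Fin n → Bool),
      cn S t y = y ∨ ∀ k ∈ S, y k = true := by
    intro S t y
    by_cases h : ∀ k ∈ S, y k = true
    · exact Or.inr h
    · left
      ext k
      simp [cn, h]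
  refine comm_threeCycle _ _ (fun _ => true) (cnp_mul_self _ _ _) (cnp_mul_self _ _ _) ?_ ?_ ?_
  · intro y
    rcases fix A j y with h | h
    · exact Or.inl h
    rcases fix B i y with h' | h'
    · exact Or.inr (Or.inl h')
    refine Or.inr (Or.inr ?_)
    ext k
    by_cases hk : k ∈ A
    · exact h k hk
    · refine h' k ?_
      simp [A, B, i, j, a, b, Fin.ext_iff] at hk ⊢
      omega
  · intro h
    have := congrFun h j
    rw [cnp_apply, cn_target] at this
    simp at this
  · intro h
    have := congrFun h i
    rw [cnp_apply, cn_target] at this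
    simp at this

theorem exists_translation {n : ℕ} (S : Finset (Fin n)) : ∃ h ∈ HG n, ∀ x j,
    h x j = if j ∈ S then !(x j) else x j := by
  induction S using Finset.induction_on with
  | empty => exact ⟨1, one_mem _, by simp⟩
  | insert a S ha ih =>
    obtain ⟨h, hh, hx⟩ := ih
    refine ⟨cnp ∅ a (by simp) * h, mul_mem (cnp_mem_small _ _ _ (by simp)) hh, fun x j => ?_⟩
    rw [Equiv.Perm.mul_apply, cnp_apply]
    by_cases hj : j = a
    · subst hj
      rw [cn_target, hx]
      simp [ha]
    · rw [cn_other _ _ _ hj, hx]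
      simp [hj]

theorem exists_fan {n : ℕ} (i : Fin n) (S : Finset (Fin n)) : i ∉ S → ∃ h ∈ HG n, ∀ x j,
    h x j = if j ∈ S then xor (x j) (x i) else x j := by
  induction S using Finset.induction_on with
  | empty => intro _; exact ⟨1, one_mem _, by simp⟩
  | insert a S ha ih =>
    intro hi
    simp only [Finset.mem_insert, not_or] at hi
    obtain ⟨h, hh, hx⟩ := ih hi.2
    refine ⟨cnp {i} a (by simpa using Ne.symm hi.1) * h,
      mul_mem (cnp_mem_small _ _ _ (by simp)) hh, fun x j => ?_⟩
    rw [Equiv.Perm.mul_apply, cnp_apply]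
    by_cases hj : j = a
    · subst hj
      rw [cn_target, hx]
      simp [ha, hx, hi.2]
    · rw [cn_other _ _ _ hj, hx]
      simp [hj]

theorem exists_normalize {n : ℕ} (a b : Fin n → Bool) (hab : a ≠ b) :
    ∃ h ∈ HG n, h a = (fun _ => false) ∧ h b = (fun _ => true) := by
  obtain ⟨i, hi⟩ := Function.ne_iff.1 hab
  obtain ⟨h1, hh1, hx1⟩ := exists_translation (Finset.univ.filter fun j => a j = true)
  obtain ⟨h2, hh2, hx2⟩ := exists_fan i (Finset.univ.filter fun j => a j = b j) (by simpa using hi)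
  refine ⟨h2 * h1, mul_mem hh2 hh1, ?_, ?_⟩
  · ext j
    simp only [Equiv.Perm.mul_apply, hx1, hx2, Finset.mem_filter, Finset.mem_univ, true_and]
    cases a i <;> cases a j <;> simp
  · ext j
    simp only [Equiv.Perm.mul_apply, hx1, hx2, Finset.mem_filter, Finset.mem_univ, true_and]
    revert hi
    cases a i <;> cases a j <;> cases b i <;> cases b j <;> simp

theorem alt_le {n : ℕ} (hn : 4 ≤ n) : alternatingGroup (Fin n → Bool) ≤ HG n := by
  have : MulAction.IsMultiplyPretransitive (HG n) (Fin n → Bool) 2 := by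
    rw [MulAction.is_two_pretransitive_iff]
    intro a b c d hab hcd
    obtain ⟨h, hh, h1, h2⟩ := exists_normalize a b hab
    obtain ⟨k, hk, k1, k2⟩ := exists_normalize c d hcd
    refine ⟨⟨k⁻¹ * h, mul_mem (inv_mem hk) hh⟩, ?_, ?_⟩
    · change k⁻¹ (h a) = c
      rw [h1, ← k1]; simp
    · change k⁻¹ (h b) = d
      rw [h2, ← k2]; simp
  have hp : MulAction.IsPreprimitive (HG n) (Fin n → Bool) :=
    MulAction.isPreprimitive_of_is_two_pretransitive this
  obtain ⟨g, hg, h3⟩ := exists_threeCycle hn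
  exact Equiv.Perm.alternatingGroup_le_of_isPreprimitive_of_isThreeCycle_mem hp h3 hg

end RevCirc
namespace RevCirc

/-- Evaluation of a layer described by the gate acting on each target. -/
def layerEval {m : ℕ} (k : Fin m → Option (Gate m)) (x : Fin m → Bool) : Fin m → Bool :=
  fun i => (k i).elim (x i) fun g => xor (x i) (decide (∀ j ∈ g.controls, x j = true))

theorem layerEval_find {m : ℕ} (p : List (Gate m)) (hp : DepthOne p) (x : Fin m → Bool) :
    evalCircuit p x = layerEval (fun i => p.find? fun g => decide (g.target = i)) x := by
  induction p generalizing x with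
  | nil => rfl
  | cons g p ih =>
    obtain ⟨h1, h2⟩ := List.pairwise_cons.1 hp
    have e : evalCircuit (g :: p) x = evalCircuit p (g.apply x) := rfl
    rw [e, ih h2]
    ext i
    by_cases hi : g.target = i
    · have hn : p.find? (fun g => decide (g.target = i)) = none := by
        rw [List.find?_eq_none]
        intro g' hg' he
        have he : g'.target = i := by simpa using he
        have hd := h1 g' hg'
        rw [Finset.disjoint_left] at hd
        exact hd (a := i) (by simp [Gate.support, hi]) (by simp [Gate.support, he])
      simp only [layerEval, hn, List.find?_cons, hi]
      simp [Gate.apply, hi]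
    · simp only [layerEval, List.find?_cons, hi, decide_false]
      have hx : g.apply x i = x i := by simp [Gate.apply, Ne.symm hi]
      rw [hx]
      cases hf : p.find? (fun g => decide (g.target = i)) with
      | none => rfl
      | some g' =>
        have hg' := List.mem_of_find?_eq_some hf
        have hd := h1 g' hg'
        rw [Finset.disjoint_left] at hd
        have : (∀ j ∈ g'.controls, g.apply x j = true) ↔ (∀ j ∈ g'.controls, x j = true) := by
          refine forall₂_congr fun j hj => ?_
          have hne : j ≠ g.target := by
            rintro rfl
            exact hd (a := g.target) (by simp [Gate.support]) (by simp [Gate.support, hj])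
          simp [Gate.apply, hne]
        simp only [Option.elim, this]

theorem card_option_gate {m : ℕ} (hm : 2 ≤ m) : Fintype.card (Option (Gate m)) ≤ m ^ 3 := by
  let F : Fin m × Fin m × Fin m → Option (Gate m) := fun p =>
    if p.2.1 ≠ p.1 ∧ p.2.2 = p.1 then none
    else some ⟨(p.1, ({p.2.1, p.2.2} : Finset (Fin m)).erase p.1),
      (Finset.card_le_card (Finset.erase_subset _ _)).trans Finset.card_le_two, by simp⟩
  have hF : Function.Surjective F := by
    rintro (_ | ⟨⟨t, S⟩, hS, ht⟩)
    · refine ⟨(⟨0, by omega⟩, ⟨1, by omega⟩, ⟨0, by omega⟩), ?_⟩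
      simp [F]
    · simp only at hS ht
      have hc : S.card = 0 ∨ S.card = 1 ∨ S.card = 2 := by omega
      rcases hc with hc | hc | hc
      · rw [Finset.card_eq_zero] at hc
        subst hc
        refine ⟨(t, t, t), ?_⟩
        simp [F]
      · obtain ⟨a, rfl⟩ := Finset.card_eq_one.1 hc
        refine ⟨(t, a, a), ?_⟩
        have hne : a ≠ t := by rintro rfl; simp at ht
        simp [F, hne, hne.symm]
      · obtain ⟨a, b, hab, rfl⟩ := Finset.card_eq_two.1 hc
        refine ⟨(t, a, b), ?_⟩
        simp only [Finset.mem_insert, Finset.mem_singleton, not_or] at ht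
        simp [F, Ne.symm ht.1, Ne.symm ht.2, ht.1, ht.2]
  have := Fintype.card_le_of_surjective F hF
  simpa [pow_succ, mul_assoc] using this

/-- Transformation given by `D` layers. -/
def layersEval {m : ℕ} (l : List (Fin m → Option (Gate m))) (x : Fin m → Bool) :
    Fin m → Bool :=
  l.foldl (fun y k => layerEval k y) x

theorem exists_layers {m : ℕ} (parts : List (List (Gate m))) (h : ∀ p ∈ parts, DepthOne p) :
    ∃ l : List (Fin m → Option (Gate m)), l.length = parts.length ∧
      ∀ x, evalCircuit parts.flatten x = layersEval l x := by
  induction parts with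
  | nil => exact ⟨[], rfl, fun x => rfl⟩
  | cons p parts ih =>
    obtain ⟨l, hl, he⟩ := ih fun p hp => h p (List.mem_cons_of_mem _ hp)
    refine ⟨(fun i => p.find? fun g => decide (g.target = i)) :: l, by simp [hl], fun x => ?_⟩
    have e1 : evalCircuit (p :: parts).flatten x = evalCircuit parts.flatten (evalCircuit p x) := by
      simp [evalCircuit, List.foldl_append]
    rw [e1, he, layerEval_find p (h p List.mem_cons_self)]
    rfl

theorem depth_spec {m : ℕ} (c : List (Gate m)) : ∃ parts : List (List (Gate m)),
    parts.flatten = c ∧ (∀ p ∈ parts, DepthOne p) ∧ parts.length = depth c := by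
  refine Nat.sInf_mem (s := {d | ∃ parts : List (List (Gate m)),
    parts.flatten = c ∧ (∀ p ∈ parts, DepthOne p) ∧ parts.length = d})
    ⟨c.length, c.map fun g => [g], ?_, ?_, by simp⟩
  · induction c with
    | nil => rfl
    | cons g c ih => simp [ih]
  · intro p hp
    obtain ⟨g, _, rfl⟩ := List.mem_map.1 hp
    exact List.pairwise_singleton _ _

theorem layersEval_pad {m : ℕ} (r : ℕ) (x : Fin m → Bool) :
    layersEval (List.replicate r fun _ => none) x = x := by
  induction r with
  | zero => rfl
  | succ r ih => exact ih

theorem exists_layers_of_mem {n q : ℕ} {f : (Fin n → Bool) → (Fin n → Bool)}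
    (hf : f ∈ FSet n q) : ∃ (l : List.Vector (Fin (n + q) → Option (Gate (n + q))) (ShannonD n q))
      (s : Fin n → Fin (n + q)), ∀ x i, layersEval l.1 (expand n q x) (s i) = f x i := by
  have hD : Dmin n q f ≤ ShannonD n q :=
    le_csSup (Set.Finite.bddAbove ((Set.toFinite (FSet n q)).image _)) ⟨f, hf, rfl⟩
  obtain ⟨c, ⟨π, hπ⟩, hd⟩ : ∃ c : List (Gate (n + q)), implements n q c f ∧
      depth c = Dmin n q f := by
    obtain ⟨c, hc⟩ := hf
    exact Nat.sInf_mem (s := {d | ∃ c : List (Gate (n + q)), implements n q c f ∧ depth c = d})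
      ⟨depth c, c, hc, rfl⟩
  obtain ⟨parts, rfl, h1, h2⟩ := depth_spec c
  obtain ⟨l, hl, he⟩ := exists_layers parts h1
  refine ⟨⟨List.replicate (ShannonD n q - Dmin n q f) (fun _ => none) ++ l, ?_⟩,
    fun i => π (Fin.castLE (Nat.le_add_right n q) i), fun x i => ?_⟩
  · simp only [List.length_append, List.length_replicate]
    omega
  · rw [← hπ x i, he]
    have := layersEval_pad (ShannonD n q - Dmin n q f) (expand n q x)
    simp only [layersEval, List.foldl_append] at *
    rw [this]

theorem card_FSet_le {n q : ℕ} (hm : 2 ≤ n + q) :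
    Nat.card (FSet n q) ≤ (n + q) ^ (n + 3 * (n + q) * ShannonD n q) := by
  let Φ : List.Vector (Fin (n + q) → Option (Gate (n + q))) (ShannonD n q) ×
      (Fin n → Fin (n + q)) → ((Fin n → Bool) → (Fin n → Bool)) :=
    fun p x i => layersEval p.1.1 (expand n q x) (p.2 i)
  have hsub : FSet n q ⊆ Set.range Φ := by
    intro f hf
    obtain ⟨l, s, h⟩ := exists_layers_of_mem hf
    exact ⟨(l, s), by ext x i; exact h x i⟩
  have h1 : Nat.card (FSet n q) ≤ Nat.card (Set.range Φ) :=
    Nat.card_mono (Set.toFinite _) hsub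
  have h2 := Finite.card_range_le Φ
  refine (h1.trans h2).trans ?_
  rw [Nat.card_eq_fintype_card, Fintype.card_prod, card_vector, Fintype.card_fun,
    Fintype.card_fun, Fintype.card_fin, Fintype.card_fin, mul_comm, pow_add (n + q) n]
  refine Nat.mul_le_mul_left _ ?_
  rw [pow_mul, pow_mul]
  exact Nat.pow_le_pow_left (Nat.pow_le_pow_left (card_option_gate hm) _) _

/-- Embedding of gates. -/
def liftGate {n : ℕ} (q : ℕ) (g : Gate n) : Gate (n + q) :=
  ⟨(Fin.castAdd q g.1.1, g.1.2.map (Fin.castAddEmb q)), by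
    rw [Finset.card_map]; exact g.2.1, by
    intro h
    obtain ⟨j, hj, he⟩ := Finset.mem_map.1 h
    have : j = g.1.1 := Fin.castAdd_injective n q he
    exact g.2.2 (this ▸ hj)⟩

theorem expand_castAdd (n q : ℕ) (x : Fin n → Bool) (i : Fin n) :
    expand n q x (Fin.castAdd q i) = x i := by simp [expand]

theorem liftGate_apply {n : ℕ} (q : ℕ) (g : Gate n) (x : Fin n → Bool) :
    (liftGate q g).apply (expand n q x) = expand n q (g.apply x) := by
  have hc : (∀ j ∈ (liftGate q g).controls, expand n q x j = true) ↔
      (∀ j ∈ g.controls, x j = true) := by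
    simp [liftGate, Gate.controls, expand_castAdd]
  ext i
  induction i using Fin.addCases with
  | left i =>
    rw [expand_castAdd]
    simp only [Gate.apply, hc, expand_castAdd]
    have ht : (liftGate q g).target = Fin.castAdd q g.target := rfl
    rw [ht]
    simp only [Fin.castAdd_inj]
  | right i =>
    have : Fin.natAdd n i ≠ (liftGate q g).target := by
      simp only [liftGate, Gate.target, ne_eq, Fin.ext_iff, Fin.val_natAdd, Fin.val_castAdd]
      omega
    simp [Gate.apply, this, expand]

theorem lift_eval {n : ℕ} (q : ℕ) (c : List (Gate n)) (x : Fin n → Bool) :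
    evalCircuit (c.map (liftGate q)) (expand n q x) = expand n q (evalCircuit c x) := by
  induction c generalizing x with
  | nil => rfl
  | cons g c ih =>
    have := ih (g.apply x)
    simp only [evalCircuit, List.map_cons, List.foldl_cons, liftGate_apply] at *
    exact this

theorem le_card_FSet {n : ℕ} (q : ℕ) (hn : 4 ≤ n) : (2 ^ n).factorial ≤ 2 * Nat.card (FSet n q) := by
  have : Nonempty (Fin n) := ⟨⟨0, by omega⟩⟩
  have h := two_mul_nat_card_alternatingGroup (α := Fin n → Bool)
  have hc : Nat.card (Equiv.Perm (Fin n → Bool)) = (2 ^ n).factorial := by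
    rw [Nat.card_perm]; simp
  rw [← hc, ← h]
  refine Nat.mul_le_mul_left _ ?_
  refine Nat.card_le_card_of_injective
    (fun g : alternatingGroup (Fin n → Bool) => (⟨fun x => g.1 x, ?_⟩ : FSet n q)) ?_
  · obtain ⟨c, hc⟩ := alt_le hn g.2
    refine ⟨c.map (liftGate q), 1, fun x i => ?_⟩
    rw [lift_eval, hc]
    exact expand_castAdd n q _ i
  · intro a b hab
    have := congrArg Subtype.val hab
    ext1
    ext1 x
    exact congrFun this x

theorem factorial_bound (N : ℕ) (hN : 3 ≤ N) : 2 * (N : ℝ) ^ N ≤ 4 ^ N * (N.factorial : ℝ) := by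
  have h1 := Real.pow_div_factorial_le_exp (x := (N : ℝ)) (by positivity) N
  have hf : (0 : ℝ) < N.factorial := by positivity
  rw [div_le_iff₀ hf] at h1
  have h2 : Real.exp N ≤ 3 ^ N := by
    rw [← mul_one (N : ℝ), Real.exp_nat_mul]
    exact pow_le_pow_left₀ (Real.exp_pos _).le (Real.exp_one_lt_d9.le.trans (by norm_num)) _
  have h3 : (2 : ℝ) * 3 ^ N ≤ 4 ^ N := by
    induction N, hN using Nat.le_induction with
    | base => norm_num
    | succ k hk ih =>
      clear h1 h2 hf
      have : (2 : ℝ) * 3 ^ k ≤ 4 ^ k := by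
        clear ih
        induction k, hk using Nat.le_induction with
        | base => norm_num
        | succ k hk ih => rw [pow_succ, pow_succ]; nlinarith [pow_pos (by norm_num : (0:ℝ) < 4) k]
      rw [pow_succ, pow_succ]; nlinarith [pow_pos (by norm_num : (0:ℝ) < 4) k]
  calc 2 * (N : ℝ) ^ N ≤ 2 * (3 ^ N * N.factorial) := by
        gcongr; exact h1.trans (by gcongr)
    _ = 2 * 3 ^ N * N.factorial := by ring
    _ ≤ _ := by gcongr

theorem main_ineq {n q : ℕ} (hn : 4 ≤ n) :
    (2 : ℝ) ^ ((n - 2) * 2 ^ n) ≤ ((n + q : ℕ) : ℝ) ^ (n + 3 * (n + q) * ShannonD n q) := by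
  have h1 : (2 ^ n).factorial ≤ 2 * (n + q) ^ (n + 3 * (n + q) * ShannonD n q) :=
    (le_card_FSet q hn).trans (Nat.mul_le_mul_left _ (card_FSet_le (by omega)))
  have h1' : ((2 ^ n).factorial : ℝ) ≤
      2 * ((n + q : ℕ) : ℝ) ^ (n + 3 * (n + q) * ShannonD n q) := by exact_mod_cast h1
  have hN : 3 ≤ 2 ^ n := by
    have : 2 ^ 4 ≤ 2 ^ n := Nat.pow_le_pow_right (by norm_num) hn
    omega
  have h2 := factorial_bound (2 ^ n) hN
  have e : (((2 ^ n : ℕ) : ℝ)) ^ (2 ^ n) = 4 ^ (2 ^ n) * 2 ^ ((n - 2) * 2 ^ n) := by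
    rw [pow_mul, ← mul_pow]
    congr 1
    obtain ⟨k, rfl⟩ : ∃ k, n = k + 2 := ⟨n - 2, by omega⟩
    push_cast
    simp only [Nat.add_sub_cancel, pow_add]
    ring
  rw [e] at h2
  have h4 : (0 : ℝ) < 4 ^ (2 ^ n) := by positivity
  have h3 : (2 : ℝ) * 2 ^ ((n - 2) * 2 ^ n) ≤ ((2 ^ n).factorial : ℝ) := by
    refine le_of_mul_le_mul_left ?_ h4
    linarith
  linarith

end RevCirc

/-- Theorem: lower bound for the Shannon depth function `D(n,q)`. -/
theorem shannonD_lower_bound :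
    ∃ n₀ : ℕ, ∀ n q : ℕ, n > n₀ →
      (RevCirc.ShannonD n q : ℝ) ≥
        2 ^ n * ((n : ℝ) - 2) / (3 * ((n : ℝ) + (q : ℝ)) * Real.logb 2 ((n : ℝ) + (q : ℝ)))
          - (n : ℝ) / (3 * ((n : ℝ) + (q : ℝ))) := by
  refine ⟨4, fun n q hn => ?_⟩
  have h := RevCirc.main_ineq (n := n) (q := q) (by omega)
  have hl := Real.logb_le_logb_of_le (b := 2) (by norm_num) (by positivity) h
  rw [Real.logb_pow, Real.logb_pow, Real.logb_self_eq_one (by norm_num)] at hl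
  push_cast [Nat.cast_sub (show 2 ≤ n by omega)] at hl
  have hm : (1 : ℝ) < (n : ℝ) + q := by
    have : (4 : ℝ) < n := by exact_mod_cast hn
    have : (0 : ℝ) ≤ q := by positivity
    linarith
  have hL : 0 < Real.logb 2 ((n : ℝ) + q) := Real.logb_pos (by norm_num) hm
  generalize Real.logb 2 ((n : ℝ) + q) = L at *
  have hm0 : (0 : ℝ) < (n : ℝ) + q := by linarith
  rw [ge_iff_le, sub_le_iff_le_add, div_le_iff₀ (by positivity)]
  have e : ((RevCirc.ShannonD n q : ℝ) + n / (3 * ((n : ℝ) + q))) * (3 * ((n : ℝ) + q) * L)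
      = (n + 3 * ((n : ℝ) + q) * RevCirc.ShannonD n q) * L := by
    field_simp
    ring
  rw [e]
  linarith
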